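/- arXiv:2309.07964 — 2 statements merged into one kernel-verified Lean document; each statement's English description precedes it below -/
import Mathlib

section
/- For all positive integers k and f with f ≥ 6k, there exist a finite undirected unweighted simple graph G, a set F of at most f edges of G, and a path π that is a shortest path between its endpoints in G∖F, such that π cannot be partitioned into 2k−1 subpaths each of which is a (⌊f/k⌋ − 2)-fault replacement path in G. -/
open SimpleGraph

/-- `supp` is the vertex list of a shortest `u`–`v` path in the graph `H`
(shortest = path of minimum length, counted in edges, among all `u`–`v` paths). -/
def IsShortestSupp {V : Type} (H : SimpleGraph V) (u v : V) (supp : List V) : Prop :=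
  ∃ p : H.Walk u v, p.support = supp ∧ p.IsPath ∧
    ∀ q : H.Walk u v, q.IsPath → p.length ≤ q.length

/-- `supp` is the vertex list of an `r`-fault replacement `u`–`v` path in `G`: for some set
`F'` of at most `r` edges of `G`, it is a shortest `u`–`v` path in `G \ F'`. -/
def IsReplSupp {V : Type} (G : SimpleGraph V) (r : ℕ) (u v : V) (supp : List V) : Prop :=
  ∃ F' : Set (Sym2 V), F' ⊆ G.edgeSet ∧ F'.ncard ≤ r ∧
    IsShortestSupp (G.deleteEdges F') u v supp

theorem aux_walkOf {V : Type} (H : SimpleGraph V) (w : ℕ → V) (n : ℕ)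
    (h : ∀ t, t < n → H.Adj (w t) (w (t + 1))) :
    ∃ p : H.Walk (w 0) (w n), p.support = (List.range (n + 1)).map w := by
  induction n with
  | zero => exact ⟨Walk.nil, by simp⟩
  | succ n ih =>
    obtain ⟨p, hp⟩ := ih (fun t ht => h t (by omega))
    refine ⟨p.concat (h n (by omega)), ?_⟩
    rw [Walk.support_concat, hp, List.range_succ (n := n + 1)]
    simp

theorem aux_lane {V : Type} (H : SimpleGraph V) (w : ℕ → V) (y n : ℕ)
    (h : ∀ t, t < n → H.Adj (w (y + t)) (w (y + t + 1))) :
    ∃ p : H.Walk (w y) (w (y + n)), p.length = n := by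
  obtain ⟨p, hp⟩ := aux_walkOf H (fun t => w (y + t)) n h
  refine ⟨p, ?_⟩
  have := congrArg List.length hp
  simpa using this

theorem aux_pot {V : Type} (H : SimpleGraph V) (pos : V → ℕ)
    (h : ∀ u v, H.Adj u v → pos v ≤ pos u + 1) {u v : V} (q : H.Walk u v) :
    pos v ≤ pos u + q.length := by
  induction q with
  | nil => simp
  | cons hh p ih =>
    have := h _ _ hh
    simp only [Walk.length_cons]
    omega

theorem aux_pigeon (k : ℕ) (ix p : ℕ → ℕ) (h0 : ix 0 = 0) (M : ℕ)
    (hM : p M ≤ ix M) (hpos : 0 < M) :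
    ∃ j, j < M ∧ ix j ≤ p j ∧ p (j + 1) ≤ ix (j + 1) := by
  by_contra! hc
  have : ∀ j, j ≤ M → ix j ≤ p j ∧ (0 < j → ix j < p j) := by
    intro j
    induction j with
    | zero => intro _; simp [h0]
    | succ j ih =>
      intro hj
      have := hc j (by omega) (ih (by omega)).1
      omega
  have := (this M le_rfl).2 hpos
  omega

/-- Abstract reduction. -/
theorem aux_main {V : Type} (G : SimpleGraph V) (r M L : ℕ) (hM : 0 < M) (w : ℕ → V) (N : ℕ)
    (hN : L * M ≤ N)
    (hbad : ∀ m, m < M → ∀ F' : Set (Sym2 V), F' ⊆ G.edgeSet → F'.ncard ≤ r →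
      ∃ q : (G.deleteEdges F').Walk (w (L * m)) (w (L * (m + 1))), q.length < L)
    (s : V) (supp : List V) (hs : supp = (List.range (N + 1)).map w)
    (ix : ℕ → ℕ) (h0 : ix 0 = 0) (h1 : ix M = N) (hmono : ∀ j, j < M → ix j ≤ ix (j + 1))
    (hr : ∀ j, j < M → IsReplSupp G r (supp.getD (ix j) s) (supp.getD (ix (j + 1)) s)
       ((supp.drop (ix j)).take (ix (j + 1) - ix j + 1))) : False := by
  obtain ⟨j, hj, hj1, hj2⟩ := aux_pigeon M ix (fun m => L * m) h0 M (by simpa [h1] using hN) hM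
  have hup : ∀ d, j + d ≤ M → ix j ≤ ix (j + d) := by
    intro d
    induction d with
    | zero => simp
    | succ d ih =>
      intro hd
      exact (ih (by omega)).trans (hmono (j + d) (by omega))
  have hup2 : ∀ d, j + 1 + d ≤ M → ix (j + 1) ≤ ix (j + 1 + d) := by
    intro d
    induction d with
    | zero => simp
    | succ d ih =>
      intro hd
      exact (ih (by omega)).trans (hmono (j + 1 + d) (by omega))
  have hle : ix (j + 1) ≤ N := by
    have := hup2 (M - (j + 1)) (by omega)
    rwa [show j + 1 + (M - (j + 1)) = M by omega, h1] at this
  have hjj := hmono j hj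
  have hget : ∀ t, t ≤ N → supp.getD t s = w t := by
    intro t ht
    subst hs
    simp [List.getD, List.getElem?_range (show t < N + 1 by omega)]
  have hR := hr j hj
  rw [hget _ (by omega), hget _ hle] at hR
  obtain ⟨F', hF1, hF2, p, hp1, hp2, hp3⟩ := hR
  obtain ⟨q, hq⟩ := hbad j hj F' hF1 hF2
  have hlen : p.length = ix (j + 1) - ix j := by
    have := congrArg List.length hp1
    subst hs
    simp at this
    omega
  have hvert : ∀ t, t ≤ ix (j + 1) - ix j → p.getVert t = w (ix j + t) := by
    intro t ht
    have h1 : p.support[t]? = some (w (ix j + t)) := by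
      rw [hp1]
      subst hs
      rw [List.getElem?_take_of_lt (by omega)]
      simp [List.getElem?_range (show ix j + t < N + 1 by omega)]
    have h2 := p.getVert_eq_support_getElem? (n := t) (by omega)
    rw [h1] at h2
    exact Option.some_injective _ h2
  have hLm : L * (j + 1) = L * j + L := by ring
  have e1 : p.getVert (L * j - ix j) = w (L * j) := by
    rw [hvert _ (by omega)]; congr 1; omega
  have e2 : p.getVert (L * (j + 1) - ix j) = w (L * (j + 1)) := by
    rw [hvert _ (by omega)]; congr 1; omega
  let Q := ((p.take (L * j - ix j)).append (q.copy e1.symm e2.symm)).append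
    (p.drop (L * (j + 1) - ix j))
  classical
  have hQ : Q.length < p.length := by
    simp only [Q, Walk.length_append, Walk.length_copy, Walk.take_length, Walk.drop_length]
    omega
  have h3 := hp3 Q.bypass Q.bypass_isPath
  have h4 := Q.length_bypass_le
  omega

/-- The larger lane of an edge. -/
def auxLane {V : Type} (lane : V → ℕ) : Sym2 V → ℕ :=
  Sym2.lift ⟨fun a b => max (lane a) (lane b), fun a b => max_comm _ _⟩

theorem aux_clean (T : Type) (F' : Set T) (hfin : F'.Finite) (ml : T → ℕ) (g : ℕ) (hg : 2 ≤ g)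
    (hc : F'.ncard ≤ g - 2) :
    ∃ i j, 1 ≤ i ∧ i < j ∧ j ≤ g ∧ (∀ e ∈ F', ml e ≠ i) ∧ (∀ e ∈ F', ml e ≠ j) := by
  classical
  let D : Finset ℕ := hfin.toFinset.image ml
  have hD : D.card ≤ g - 2 := by
    refine Finset.card_image_le.trans ?_
    rwa [← Set.ncard_eq_toFinset_card F' hfin]
  have h1 : 1 < (Finset.Icc 1 g \ D).card := by
    have := Finset.le_card_sdiff D (Finset.Icc 1 g)
    simp at this
    omega
  obtain ⟨a, ha, b, hb, hab⟩ := Finset.one_lt_card.1 h1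
  simp only [D, Finset.mem_sdiff, Finset.mem_Icc, Finset.mem_image, Set.Finite.mem_toFinset,
    not_exists, not_and] at ha hb
  rcases lt_or_gt_of_ne hab with h | h
  · exact ⟨a, b, ha.1.1, h, hb.1.2, ha.2, hb.2⟩
  · exact ⟨b, a, hb.1.1, h, ha.1.2, hb.2, ha.2⟩

theorem aux_bad {V : Type} [Finite V] (G : SimpleGraph V) (lane : V → ℕ)
    (mk : ℕ → ℕ → V) (g N L k : ℕ) (hg : 2 ≤ g) (hL : L = 3 * g + 2) (hN : N = L * (2 * k))
    (hlane : ∀ i x, i ≤ g → x ≤ N → lane (mk i x) = i)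
    (hadj : ∀ i i' x, i ≤ g → i' ≤ g → x + 1 ≤ N → G.Adj (mk i x) (mk i' (x + 1)))
    (hF : ∀ m i, m < k → 1 ≤ i → i ≤ g →
      G.Adj (mk 0 (L * (2 * m))) (mk i (L * (2 * m + 1) + 3 * i)))
    (m : ℕ) (hm : m < 2 * k) (F' : Set (Sym2 V)) (hc : F'.ncard ≤ g - 2) :
    ∃ q : (G.deleteEdges F').Walk (mk 0 (L * m)) (mk 0 (L * (m + 1))), q.length < L := by
  obtain ⟨i, j, hi, hij, hj, ci, cj⟩ := aux_clean _ F' (Set.toFinite _) (auxLane lane) g hg hc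
  set H := G.deleteEdges F' with hH
  have key : ∀ l, 1 ≤ l → l ≤ g → (∀ e ∈ F', auxLane lane e ≠ l) →
      ∀ i1 i2 x1 x2, x1 ≤ N → x2 ≤ N → i1 ≤ l → i2 ≤ l → max i1 i2 = l →
        G.Adj (mk i1 x1) (mk i2 x2) → H.Adj (mk i1 x1) (mk i2 x2) := by
    intro l h1 h2 hcl i1 i2 x1 x2 hx1 hx2 hi1 hi2 hmax ha
    rw [hH, SimpleGraph.deleteEdges_adj]
    refine ⟨ha, fun hmem => hcl _ hmem ?_⟩
    simp only [auxLane, Sym2.lift_mk]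
    rw [hlane _ _ (by omega) hx1, hlane _ _ (by omega) hx2, hmax]
  -- up from the base to lane `l`
  have up : ∀ l, 1 ≤ l → l ≤ g → (∀ e ∈ F', auxLane lane e ≠ l) → ∀ b n, b + 1 + n ≤ N →
      ∃ q : H.Walk (mk 0 b) (mk l (b + 1 + n)), q.length = n + 1 := by
    intro l h1 h2 hcl b n hb
    obtain ⟨q, hq⟩ := aux_lane H (mk l) (b + 1) n (fun t ht =>
      key l h1 h2 hcl _ _ _ _ (by omega) (by omega) le_rfl le_rfl (by simp)
        (hadj _ _ _ h2 h2 (by omega)))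
    exact ⟨Walk.cons (key l h1 h2 hcl _ _ _ _ (by omega) (by omega) (by omega) le_rfl (by simp)
        (hadj _ _ _ (by omega) h2 (by omega))) q, by simp [hq]⟩
  have down : ∀ l, 1 ≤ l → l ≤ g → (∀ e ∈ F', auxLane lane e ≠ l) → ∀ y n, y + n + 1 ≤ N →
      ∃ q : H.Walk (mk l y) (mk 0 (y + n + 1)), q.length = n + 1 := by
    intro l h1 h2 hcl y n hb
    obtain ⟨q, hq⟩ := aux_lane H (mk l) y n (fun t ht =>
      key l h1 h2 hcl _ _ _ _ (by omega) (by omega) le_rfl le_rfl (by simp)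
        (hadj _ _ _ h2 h2 (by omega)))
    exact ⟨q.concat (key l h1 h2 hcl _ _ _ _ (by omega) (by omega) le_rfl (by omega) (by simp)
        (hadj _ _ _ h2 (by omega) (by omega))), by simp [hq]⟩
  obtain ⟨c, hc' | hc'⟩ : ∃ c, m = 2 * c ∨ m = 2 * c + 1 := ⟨m / 2, by omega⟩
  all_goals
    have hck : c < k := by omega
    have hNN : L * (2 * c) + 2 * L ≤ N := by
      rw [hN]
      calc L * (2 * c) + 2 * L = L * (2 * (c + 1)) := by ring
        _ ≤ _ := Nat.mul_le_mul_left _ (by omega)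
    have hs1 : L * (2 * c + 1) = L * (2 * c) + L := by ring
    have hs2 : L * (2 * c + 1 + 1) = L * (2 * c) + 2 * L := by ring
    subst hc'
    have ei := key i hi (by omega) ci _ _ _ _ (by omega) (by omega) (by omega) le_rfl (by simp)
      (hF c i hck hi (by omega))
    have ej := key j (by omega) (by omega) cj _ _ _ _ (by omega) (by omega) (by omega) le_rfl
      (by simp) (hF c j hck (by omega) (by omega))
    have hU := up i hi (by omega) ci (L * (2 * c + 1)) (3 * i - 1) (by omega)
    rw [show L * (2 * c + 1) + 1 + (3 * i - 1) = L * (2 * c + 1) + 3 * i by omega] at hU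
    obtain ⟨q, hq⟩ := hU
  · exact ⟨Walk.cons ei q.reverse, by simp [hq]; omega⟩
  · have hU := down j (by omega) (by omega) cj (L * (2 * c + 1) + 3 * j) (L - 3 * j - 1)
      (by omega)
    rw [show L * (2 * c + 1) + 3 * j + (L - 3 * j - 1) + 1 = L * (2 * c + 1 + 1) by omega] at hU
    obtain ⟨q', hq'⟩ := hU
    exact ⟨q.append (Walk.cons ei.symm (Walk.cons ej q')), by simp [hq, hq']; omega⟩

/-- **Statement 3** (lower bound): for all `k, f ≥ 1` with `f ≥ 6k` there are a finite
simple graph `G`, a set `F` of at most `f` edges, and a shortest path `P` in `G \ F`,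
such that `P` cannot be partitioned into `2k - 1` subpaths (given by boundary indices into
the vertex sequence of `P`) that are each `(⌊f/k⌋ - 2)`-fault replacement paths in `G`. -/
theorem stmt_4 (k f : ℕ) (hk : 0 < k) (hf : 6 * k ≤ f) :
    ∃ (n : ℕ) (G : SimpleGraph (Fin n)) (F : Set (Sym2 (Fin n))) (s t : Fin n)
      (P : (G.deleteEdges F).Walk s t),
      F ⊆ G.edgeSet ∧ F.ncard ≤ f ∧ P.IsPath ∧
      (∀ Q : (G.deleteEdges F).Walk s t, Q.IsPath → P.length ≤ Q.length) ∧
      ¬ ∃ ix : ℕ → ℕ,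
          ix 0 = 0 ∧ ix (2 * k - 1) = P.length ∧
          (∀ j, j < 2 * k - 1 → ix j ≤ ix (j + 1)) ∧
          (∀ j, j < 2 * k - 1 →
            IsReplSupp G (f / k - 2)
              (P.support.getD (ix j) s) (P.support.getD (ix (j + 1)) s)
              ((P.support.drop (ix j)).take (ix (j + 1) - ix j + 1))) := by
  classical
  set g := f / k with hgdef
  have hg : 6 ≤ g := (Nat.le_div_iff_mul_le hk).2 hf
  obtain ⟨L, hL⟩ : ∃ L, L = 3 * g + 2 := ⟨_, rfl⟩
  obtain ⟨N, hN⟩ : ∃ N, N = L * (2 * k) := ⟨_, rfl⟩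
  obtain ⟨n, hn⟩ : ∃ n, n = (g + 1) * (N + 1) := ⟨_, rfl⟩
  have hn0 : 0 < n := by rw [hn]; positivity
  haveI : NeZero n := ⟨hn0.ne'⟩
  let pos : Fin n → ℕ := fun v => v.val % (N + 1)
  let lane : Fin n → ℕ := fun v => v.val / (N + 1)
  let mk : ℕ → ℕ → Fin n := fun i x => Fin.ofNat n ((N + 1) * i + x)
  have hval : ∀ i x, i ≤ g → x ≤ N → (mk i x).val = (N + 1) * i + x := by
    intro i x hi hx
    simp only [mk, Fin.val_ofNat]
    apply Nat.mod_eq_of_lt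
    rw [hn]
    have := Nat.mul_le_mul_left (N + 1) hi
    nlinarith
  have hlane : ∀ i x, i ≤ g → x ≤ N → lane (mk i x) = i := by
    intro i x hi hx
    simp only [lane, hval i x hi hx]
    rw [Nat.mul_add_div (by omega), Nat.div_eq_of_lt (by omega), add_zero]
  have hpos : ∀ i x, i ≤ g → x ≤ N → pos (mk i x) = x := by
    intro i x hi hx
    simp only [pos, hval i x hi hx]
    rw [Nat.mul_add_mod, Nat.mod_eq_of_lt (by omega)]
  let E : ℕ × ℕ → Sym2 (Fin n) := fun a =>
    s(mk 0 (L * (2 * a.1)), mk a.2 (L * (2 * a.1 + 1) + 3 * a.2))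
  let F : Set (Sym2 (Fin n)) := ((Finset.range k ×ˢ Finset.Icc 1 g).image E : Finset _)
  have hbd : ∀ m i, m < k → i ≤ g → L * (2 * m) ≤ N ∧ L * (2 * m + 1) + 3 * i ≤ N ∧
      L * (2 * m) + 1 < L * (2 * m + 1) + 3 * i := by
    intro m i hm hi
    have h1 : L * (2 * m) + 2 * L ≤ N := by
      rw [hN]
      calc L * (2 * m) + 2 * L = L * (2 * (m + 1)) := by ring
        _ ≤ _ := Nat.mul_le_mul_left _ (by omega)
    have hs1 : L * (2 * m + 1) = L * (2 * m) + L := by ring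
    omega
  have hFmem : ∀ m i, m < k → 1 ≤ i → i ≤ g → E (m, i) ∈ F := by
    intro m i hm h1 h2
    simp only [F, Finset.coe_image]
    exact ⟨(m, i), by simp [hm, h1, h2], rfl⟩
  have hFdiag : ∀ v, s(v, v) ∉ F := by
    intro v hv
    simp only [F, Finset.coe_image] at hv
    obtain ⟨⟨m, i⟩, hmi, he⟩ := hv
    simp at hmi
    obtain ⟨b1, b2, b3⟩ := hbd m i hmi.1 hmi.2.2
    simp only [E, Sym2.eq_iff] at he
    have h1 := hpos 0 _ (by omega) b1
    have h2 := hpos i _ hmi.2.2 b2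
    rcases he with ⟨e1, e2⟩ | ⟨e1, e2⟩ <;> rw [e1] at h1 <;> rw [e2] at h2 <;> omega
  let G : SimpleGraph (Fin n) :=
    { Adj := fun u v => pos u + 1 = pos v ∨ pos v + 1 = pos u ∨ s(u, v) ∈ F
      symm := ⟨by
        intro u v h
        rw [Sym2.eq_swap]
        tauto⟩
      loopless := ⟨by
        intro v h
        rcases h with h | h | h
        · omega
        · omega
        · exact hFdiag v h⟩ }
  have hGadj : ∀ u v, G.Adj u v ↔ (pos u + 1 = pos v ∨ pos v + 1 = pos u ∨ s(u, v) ∈ F) :=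
    fun u v => Iff.rfl
  have hFc : ∀ x ∈ F, ∀ u v, x = s(u, v) → pos u + 1 ≠ pos v := by
    intro x hx u v hxe huv
    simp only [F, Finset.coe_image] at hx
    obtain ⟨⟨m, i⟩, hmi, he⟩ := hx
    simp at hmi
    obtain ⟨b1, b2, b3⟩ := hbd m i hmi.1 hmi.2.2
    rw [hxe] at he
    simp only [E, Sym2.eq_iff] at he
    have h1 := hpos 0 _ (by omega) b1
    have h2 := hpos i _ hmi.2.2 b2
    rcases he with ⟨e1, e2⟩ | ⟨e1, e2⟩ <;> rw [e1] at h1 <;> rw [e2] at h2 <;> omega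
  obtain ⟨P, hP⟩ := aux_walkOf (G.deleteEdges F) (mk 0) N (by
    intro t ht
    have h1 := hpos 0 t (by omega) (by omega)
    have h2 := hpos 0 (t + 1) (by omega) (by omega)
    rw [SimpleGraph.deleteEdges_adj]
    exact ⟨Or.inl (by omega), fun h => hFc _ h _ _ rfl (by omega)⟩)
  have hPl : P.length = N := by
    have := congrArg List.length hP
    simpa using this
  refine ⟨n, G, F, _, _, P, ?_, ?_, ?_, ?_, ?_⟩
  · intro e he
    induction e using Sym2.ind with
    | _ u v => exact Or.inr (Or.inr he)
  · simp only [F, Set.ncard_coe_finset]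
    refine Finset.card_image_le.trans ?_
    simp only [Finset.card_product, Finset.card_range, Nat.card_Icc, Nat.add_sub_cancel]
    exact Nat.mul_div_le f k
  · rw [Walk.isPath_def, hP]
    refine List.Nodup.map_on ?_ List.nodup_range
    intro x hx y hy hxy
    simp only [List.mem_range] at hx hy
    have h1 := hpos 0 x (by omega) (by omega)
    rw [hxy, hpos 0 y (by omega) (by omega)] at h1
    exact h1.symm
  · intro Q _
    have := aux_pot (G.deleteEdges F) pos (by
      intro u v h
      rw [SimpleGraph.deleteEdges_adj] at h
      rcases h.1 with h1 | h1 | h1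
      · omega
      · omega
      · exact absurd h1 h.2) Q
    rw [hpos 0 _ (by omega) (by omega), hpos 0 _ (by omega) (by omega)] at this
    omega
  · rintro ⟨ix, h0, h1, h2, h3⟩
    refine aux_main G (g - 2) (2 * k - 1) L (by omega) (mk 0) N ?_ ?_ _ _ hP ix h0
      (h1.trans hPl) h2 h3
    · rw [hN]
      exact Nat.mul_le_mul_left _ (by omega)
    · intro m hm F' _ hc
      refine aux_bad G lane mk g N L k (by omega) hL hN hlane ?_ ?_ m (by omega) F' hc
      · intro i i' x hi hi' hx
        have h1 := hpos i x hi (by omega)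
        have h2 := hpos i' (x + 1) hi' hx
        exact Or.inl (by omega)
      · intro m i hm h1 h2
        exact Or.inr (Or.inr (hFmem m i hm h1 h2))
end

section
/- Let π' be a subpath of π. Then there exists a set F' ⊆ F such that π' is a shortest path between its endpoints in G∖F', and there exist injective maps φ_R : F' → F and φ_L : F' → F such that for every e ∈ F', φ_R(e) is a right base fault of some shortcut of π' containing e, and φ_L(e) is a left base fault of some shortcut of π' containing e. -/
open SimpleGraph

/-- `e` is the first edge of the list `l` (of traversed edges) that belongs to `F`. -/
def FirstFault {V : Type} (F : Set (Sym2 V)) (l : List (Sym2 V)) (e : Sym2 V) : Prop :=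
  ∃ l₁ l₂, l = l₁ ++ e :: l₂ ∧ e ∈ F ∧ ∀ e' ∈ l₁, e' ∉ F

/-- `F'` is a valid fault set for the path from `x` to `y` with vertex list `supp`:
that path is a shortest `x`–`y` path in `G \ F'`. -/
def ValidFor {V : Type} (G : SimpleGraph V) (F' : Set (Sym2 V)) (x y : V)
    (supp : List V) : Prop :=
  ∃ p : (G.deleteEdges F').Walk x y, p.support = supp ∧ p.IsPath ∧
    ∀ q : (G.deleteEdges F').Walk x y, q.IsPath → p.length ≤ q.length

theorem exists_firstFault {V : Type} (F : Set (Sym2 V)) (l : List (Sym2 V))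
    (h : ∃ e ∈ l, e ∈ F) : ∃ e, FirstFault F l e := by
  induction l with
  | nil => simp at h
  | cons a l ih =>
    by_cases ha : a ∈ F
    · exact ⟨a, [], l, rfl, ha, by simp⟩
    · obtain ⟨e, he, heF⟩ := h
      rcases List.mem_cons.1 he with rfl | he
      · exact absurd heF ha
      · obtain ⟨f, l₁, l₂, hl, hf, hn⟩ := ih ⟨e, he, heF⟩
        refine ⟨f, a :: l₁, l₂, by simp [hl], hf, ?_⟩
        intro e' he'
        rcases List.mem_cons.1 he' with rfl | he'
        · exact ha
        · exact hn e' he'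

theorem FirstFault.mem {V : Type} {F : Set (Sym2 V)} {l : List (Sym2 V)} {e : Sym2 V}
    (h : FirstFault F l e) : e ∈ F ∧ e ∈ l := by
  obtain ⟨l₁, l₂, hl, hf, -⟩ := h
  exact ⟨hf, by simp [hl]⟩

/-- Hall-type exchange argument for a minimum hitting set. -/
theorem hall_exchange {α β : Type} [Fintype α] (F : Set α) (S : Set β) (E : β → Set α)
    (B : β → α → Prop) (hB : ∀ p ∈ S, ∃ f, B p f) (hBm : ∀ p ∈ S, ∀ f, B p f → f ∈ F ∧ f ∈ E p)
    (H : Finset α) (hHF : (H : Set α) ⊆ F) (hhit : ∀ p ∈ S, ∃ e ∈ H, e ∈ E p)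
    (hmin : ∀ K : Finset α, (K : Set α) ⊆ F → (∀ p ∈ S, ∃ e ∈ K, e ∈ E p) → H.card ≤ K.card) :
    ∃ φ : α → α, Set.InjOn φ (H : Set α) ∧ ∀ e ∈ H, ∃ p ∈ S, e ∈ E p ∧ B p (φ e) := by
  classical
  let T : H → Finset α := fun e =>
    Finset.univ.filter (fun f => ∃ p ∈ S, (e : α) ∈ E p ∧ B p f)
  have hall : ∀ X : Finset H, X.card ≤ (X.biUnion T).card := by
    intro X
    by_contra! hlt
    let X' : Finset α := X.map (Function.Embedding.subtype _)
    have hX'H : X' ⊆ H := by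
      intro a ha
      simp only [X', Finset.mem_map, Function.Embedding.coe_subtype] at ha
      obtain ⟨b, -, rfl⟩ := ha
      exact b.2
    have hX'c : X'.card = X.card := Finset.card_map _
    have := hmin ((H \ X') ∪ X.biUnion T) ?_ ?_
    · have h1 := Finset.card_union_le (H \ X') (X.biUnion T)
      have h2 := Finset.card_sdiff_add_card_eq_card hX'H
      omega
    · intro a ha
      simp only [Finset.coe_union, Set.mem_union, Finset.mem_coe, Finset.mem_sdiff,
        Finset.mem_biUnion] at ha
      rcases ha with ha | ⟨b, -, hb⟩
      · exact hHF ha.1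
      · simp only [T, Finset.mem_filter] at hb
        obtain ⟨-, p, hp, -, hf⟩ := hb
        exact (hBm p hp a hf).1
    · intro p hp
      obtain ⟨e, heH, hep⟩ := hhit p hp
      by_cases heX : e ∈ X'
      · obtain ⟨f, hf⟩ := hB p hp
        refine ⟨f, ?_, (hBm p hp f hf).2⟩
        simp only [X', Finset.mem_map, Function.Embedding.coe_subtype] at heX
        obtain ⟨b, hb, rfl⟩ := heX
        refine Finset.mem_union_right _ (Finset.mem_biUnion.2 ⟨b, hb, ?_⟩)
        simp only [T, Finset.mem_filter]
        exact ⟨Finset.mem_univ _, p, hp, hep, hf⟩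
      · exact ⟨e, Finset.mem_union_left _ (Finset.mem_sdiff.2 ⟨heH, heX⟩), hep⟩
  obtain ⟨g, hg, hgT⟩ := (Finset.all_card_le_biUnion_card_iff_exists_injective T).1 hall
  refine ⟨fun a => if h : a ∈ H then g ⟨a, h⟩ else a, ?_, ?_⟩
  · intro a ha b hb hab
    have ha' : a ∈ H := ha
    have hb' : b ∈ H := hb
    simp only [ha', hb', dif_pos] at hab
    exact congrArg Subtype.val (hg hab)
  · intro e he
    have := hgT ⟨e, he⟩
    simp only [T, Finset.mem_filter] at this
    simpa only [he, dif_pos] using this.2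

theorem subpath_shortest {V : Type} (G : SimpleGraph V) (s t : V) (P : G.Walk s t)
    (hPshort : ∀ Q : G.Walk s t, Q.IsPath → P.length ≤ Q.length)
    (x y : V) (P' : G.Walk x y) (hsub : P'.support <:+: P.support) (q : G.Walk x y) :
    P'.length ≤ q.length := by
  classical
  obtain ⟨l₁, l₂, h⟩ := hsub
  have hlen := congrArg List.length h
  simp only [List.length_append, Walk.length_support] at hlen
  have hx : P.getVert l₁.length = x := by
    have h1 : P.support[l₁.length]? = some x := by
      rw [← h, List.append_assoc, List.getElem?_append_right le_rfl,
        List.getElem?_append_left (by simp)]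
      rw [Nat.sub_self, ← Walk.getVert_eq_support_getElem? P' (Nat.zero_le _)]
      simp
    rw [← Walk.getVert_eq_support_getElem? P (by omega)] at h1
    exact Option.some.inj h1
  have hy : P.getVert (l₁.length + P'.length) = y := by
    have h1 : P.support[l₁.length + P'.length]? = some y := by
      rw [← h, List.append_assoc, List.getElem?_append_right (by omega),
        List.getElem?_append_left (by simp)]
      rw [Nat.add_sub_cancel_left, ← Walk.getVert_eq_support_getElem? P' le_rfl]
      simp
    rw [← Walk.getVert_eq_support_getElem? P (by omega)] at h1
    exact Option.some.inj h1
  let A : G.Walk s x := (P.take l₁.length).copy rfl hx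
  let C : G.Walk y t := (P.drop (l₁.length + P'.length)).copy hy rfl
  let W := (A.append q).append C
  have h1 := hPshort W.bypass W.bypass_isPath
  have h2 := W.length_bypass_le_length
  have hA : A.length = l₁.length := by
    simp only [A, Walk.length_copy, Walk.take_length]; omega
  have hC : C.length = P.length - (l₁.length + P'.length) := by
    simp only [C, Walk.length_copy, Walk.drop_length]
  have hW : W.length = A.length + q.length + C.length := by simp [W]
  omega

/-- correctness of FaultReduce: let `P` be a shortest `s`–`t` path in
`G \ F` and let `P'` be a subpath of `P` with endpoints `x, y`. Then there is a set
`F' ⊆ F` such that `P'` is a shortest `x`–`y` path in `G \ F'`, together with injective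
maps `φ_R, φ_L : F' → F` such that for every `e ∈ F'`: `φ_R e` is the right base fault
(first `F`-edge traversing from `y`, i.e. along the reversed walk) of some shortcut of
`P'` (an `x`–`y` walk in `G`, possibly non-simple, of length `< |P'|`) containing `e`,
and `φ_L e` is the left base fault (first `F`-edge traversing from `x`) of some shortcut
of `P'` containing `e`. -/
theorem stmt_17 {V : Type} [Fintype V] (G : SimpleGraph V)
    (F : Set (Sym2 V)) (hF : F ⊆ G.edgeSet)
    (s t : V) (P : (G.deleteEdges F).Walk s t) (hPpath : P.IsPath)
    (hPshort : ∀ Q : (G.deleteEdges F).Walk s t, Q.IsPath → P.length ≤ Q.length)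
    (x y : V) (P' : (G.deleteEdges F).Walk x y) (hsub : P'.support <:+: P.support) :
    ∃ F' : Set (Sym2 V), F' ⊆ F ∧ ValidFor G F' x y P'.support ∧
      ∃ φR φL : Sym2 V → Sym2 V,
        Set.InjOn φR F' ∧ Set.InjOn φL F' ∧
        ∀ e ∈ F',
          (∃ p : G.Walk x y, p.length < P'.length ∧ e ∈ p.edges ∧
            FirstFault F p.reverse.edges (φR e)) ∧
          (∃ p : G.Walk x y, p.length < P'.length ∧ e ∈ p.edges ∧
            FirstFault F p.edges (φL e)) := by
  classical
  have hP'short := subpath_shortest _ s t P hPshort x y P' hsub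
  let S : Set (G.Walk x y) := {p | p.length < P'.length}
  let E : G.Walk x y → Set (Sym2 V) := fun p => {e | e ∈ p.edges}
  have hFhit : ∀ p ∈ S, ∃ e ∈ p.edges, e ∈ F := by
    intro p hp
    by_contra! hno
    have := hP'short (p.toDeleteEdges F hno)
    simp only [S, Set.mem_ofPred_eq] at hp
    simp at this
    omega
  let 𝓗 : Finset (Finset (Sym2 V)) := Finset.univ.filter
    (fun K => (K : Set (Sym2 V)) ⊆ F ∧ ∀ p ∈ S, ∃ e ∈ K, e ∈ E p)
  have hne : 𝓗.Nonempty := by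
    refine ⟨F.toFinite.toFinset, ?_⟩
    simp only [𝓗, Finset.mem_filter]
    refine ⟨Finset.mem_univ _, by simp, ?_⟩
    intro p hp
    obtain ⟨e, he, heF⟩ := hFhit p hp
    exact ⟨e, by simpa using heF, he⟩
  obtain ⟨H, hH, hHmin⟩ := Finset.exists_min_image 𝓗 Finset.card hne
  simp only [𝓗, Finset.mem_filter, Finset.mem_univ, true_and] at hH hHmin
  obtain ⟨hHF, hhit⟩ := hH
  obtain ⟨φR, hRi, hR⟩ := hall_exchange F S E (fun p f => FirstFault F p.reverse.edges f)
    (by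
      intro p hp
      obtain ⟨e, he, heF⟩ := hFhit p hp
      exact exists_firstFault F _ ⟨e, by simpa using he, heF⟩)
    (by
      intro p _ f hf
      have := hf.mem
      exact ⟨this.1, by simpa [E] using this.2⟩)
    H hHF hhit (fun K h1 h2 => hHmin K ⟨h1, h2⟩)
  obtain ⟨φL, hLi, hL⟩ := hall_exchange F S E (fun p f => FirstFault F p.edges f)
    (by
      intro p hp
      obtain ⟨e, he, heF⟩ := hFhit p hp
      exact exists_firstFault F _ ⟨e, he, heF⟩)
    (fun p _ f hf => hf.mem)
    H hHF hhit (fun K h1 h2 => hHmin K ⟨h1, h2⟩)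
  refine ⟨H, hHF, ?_, φR, φL, hRi, hLi, ?_⟩
  · have hle : G.deleteEdges F ≤ G.deleteEdges (H : Set (Sym2 V)) :=
      SimpleGraph.deleteEdges_anti hHF
    have hsupp : (P'.mapLe hle).support = P'.support := by simp
    refine ⟨P'.mapLe hle, hsupp, ?_, ?_⟩
    · rw [Walk.isPath_def, hsupp]
      exact (hPpath.support_nodup).sublist hsub.sublist
    · intro q _
      by_contra! hlt
      have hlt' : q.length < P'.length := by simpa [Walk.mapLe] using hlt
      obtain ⟨e, heH, heq⟩ := hhit (q.mapLe (SimpleGraph.deleteEdges_le _))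
        (by simpa [S, Walk.mapLe] using hlt')
      have heq' : e ∈ q.edges := by simpa [E] using heq
      have := q.edges_subset_edgeSet heq'
      rw [SimpleGraph.edgeSet_deleteEdges] at this
      exact this.2 heH
  · intro e he
    exact ⟨hR e he, hL e he⟩
end
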